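/- arXiv:2312.00001 — 3 statements merged into one kernel-verified Lean document; each statement's English description precedes it below -/
import Mathlib

section
/- For n = 3: every reciprocal positive 3×3 matrix A lies in the image of the action L applied to consistent matrices; that is, for every A ∈ PC_3 there exist g ∈ (ℝ_+^*)^3 and a consistent matrix C ∈ CPC_3 with A = L(g, C). -/
/-- The action `L` of `G_n = (ℝ_+^*)^n` on positive matrices:
`L(g,A)_{ij} = g i * A i j` if `i < j`, `(g i)⁻¹ * A i j` if `i > j`, and `A i i` on the
diagonal. -/
noncomputable def Laction {n : ℕ} (g : Fin n → ℝ) (A : Matrix (Fin n) (Fin n) ℝ) :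
    Matrix (Fin n) (Fin n) ℝ :=
  fun i j => if i < j then g i * A i j else if j < i then (g i)⁻¹ * A i j else A i j

/-- Every reciprocal positive `3 × 3` matrix is of the form `L(g, C)` for some
`g ∈ (ℝ_+^*)^3` and some consistent positive matrix `C`, i.e. `L(G₃, CPC₃) = PC₃`. -/
theorem pc3_eq_L_of_cpc3 (A : Matrix (Fin 3) (Fin 3) ℝ)
    (hpos : ∀ i j, 0 < A i j) (hrec : ∀ i j, A j i = (A i j)⁻¹) :
    ∃ (g : Fin 3 → ℝ) (C : Matrix (Fin 3) (Fin 3) ℝ),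
      (∀ i, 0 < g i) ∧ (∀ i j, 0 < C i j) ∧
      (∀ i j k, C i j * C j k = C i k) ∧ A = Laction g C := by
  have ha := hpos 0 1
  have hb := hpos 1 2
  have hc := hpos 0 2
  have h10 := hrec 0 1
  have h21 := hrec 1 2
  have h20 := hrec 0 2
  have hd : ∀ i, A i i = 1 := by
    intro i
    have h1 := hrec i i
    have h2 := hpos i i
    have h3 : A i i * A i i = 1 := by
      nth_rewrite 1 [h1]
      exact inv_mul_cancel₀ h2.ne'
    nlinarith
  have h00 := hd 0
  have h11 := hd 1
  have h22 := hd 2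
  obtain ⟨w, hw⟩ : ∃ w : Fin 3 → ℝ,
      w = ![A 0 2 ^ 2 / (A 0 1 * A 1 2), A 0 2 / A 0 1, 1] := ⟨_, rfl⟩
  have hwpos : ∀ i, 0 < w i := by
    intro i
    subst hw
    fin_cases i <;> simp <;> positivity
  refine ⟨fun _ => A 0 1 * A 1 2 / A 0 2, fun i j => w i / w j, fun _ => by positivity,
    fun i j => div_pos (hwpos i) (hwpos j), ?_, ?_⟩
  · intro i j k
    have := (hwpos j).ne'
    have := (hwpos k).ne'
    field_simp
  · subst hw
    ext i j
    fin_cases i <;> fin_cases j <;>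
      simp [Laction, h10, h21, h20, h00, h11, h22] <;> field_simp
end

section
/- For every n ≥ 4 there exists a reciprocal positive n×n matrix A ∈ PC_n that is not of the form L(g, C) for any g ∈ (ℝ_+^*)^n and any consistent matrix C ∈ CPC_n; that is, L(G_n, CPC_n) ≠ PC_n for n ≥ 4. -/
/-- For every `n ≥ 4` there is a reciprocal positive `n × n` matrix which is not of the
form `L(g, C)` for any `g ∈ (ℝ_+^*)^n` and consistent positive `C`, i.e.
`L(G_n, CPC_n) ≠ PC_n` for `n ≥ 4`. -/
theorem L_of_cpc_ne_pc_of_four_le (n : ℕ) (hn : 4 ≤ n) :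
    ∃ A : Matrix (Fin n) (Fin n) ℝ,
      (∀ i j, 0 < A i j) ∧ (∀ i j, A j i = (A i j)⁻¹) ∧
      ∀ (g : Fin n → ℝ) (C : Matrix (Fin n) (Fin n) ℝ),
        (∀ i, 0 < g i) → (∀ i j, 0 < C i j) → (∀ i j k, C i j * C j k = C i k) →
          A ≠ Laction g C := by
  let a : Fin n := ⟨0, by omega⟩
  let b : Fin n := ⟨1, by omega⟩
  let c : Fin n := ⟨2, by omega⟩
  let d : Fin n := ⟨3, by omega⟩
  refine ⟨fun i j => if i.val = 0 ∧ j.val = 2 then 2 else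
    if i.val = 2 ∧ j.val = 0 then 2⁻¹ else 1, ?_, ?_, ?_⟩
  · intro i j
    dsimp only
    split_ifs <;> norm_num
  · intro i j
    dsimp only
    split_ifs <;> first | omega | norm_num
  · intro g C hg hC hcons h
    have h1 := congrFun (congrFun h a) c
    have h2 := congrFun (congrFun h a) d
    have h3 := congrFun (congrFun h b) c
    have h4 := congrFun (congrFun h b) d
    simp [Laction, a, b, c, d] at h1 h2 h3 h4
    have e1 := hcons a c d
    have e2 := hcons b c d
    change 2 = g a * C a c at h1
    change 1 = g a * C a d at h2
    change 1 = g b * C b c at h3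
    change 1 = g b * C b d at h4
    have f1 : 2 * C c d = 1 := by rw [h1, h2, ← e1]; ring
    have f2 : C c d = 1 := by
      calc C c d = 1 * C c d := by ring
        _ = 1 := by nth_rewrite 1 [h3]; rw [mul_assoc, e2, ← h4]
    linarith
end

section
/- Let ε(i,j) denote the sign of i - j. The map Φ sending a positive n×n matrix A to the triple consisting of (1) the reciprocal matrix π_PC(A) with entries √(a_{ij}/a_{ji}), (2) the skew-symmetric real matrix S with S_{ij} = ε(i,j)·log √(a_{ij}·a_{ji}) for i ≠ j and S_{ii} = 0, and (3) the vector (log a_{ii})_{i} ∈ ℝⁿ, is a group isomorphism from the Hadamard group of positive n×n matrices onto the direct product PC_n × (skew-symmetric real n×n matrices, +) × (ℝⁿ, +). -/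
open scoped Matrix

/-- The reciprocal part of a positive matrix: `π_PC(A)_{ij} = √(a_{ij}/a_{ji})`. -/
noncomputable def piPC {n : ℕ} (A : Matrix (Fin n) (Fin n) ℝ) :
    Matrix (Fin n) (Fin n) ℝ :=
  fun i j => Real.sqrt (A i j / A j i)

/-- The set of positive `n × n` matrices (the Hadamard group). -/
def PosSet (n : ℕ) : Set (Matrix (Fin n) (Fin n) ℝ) := {A | ∀ i j, 0 < A i j}

/-- The group `PC_n` of reciprocal positive matrices (under Hadamard multiplication). -/
def PCSet (n : ℕ) : Set (Matrix (Fin n) (Fin n) ℝ) :=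
  {A | (∀ i j, 0 < A i j) ∧ ∀ i j, A j i = (A i j)⁻¹}

/-- The additive group of skew-symmetric real `n × n` matrices. -/
def SkewSet (n : ℕ) : Set (Matrix (Fin n) (Fin n) ℝ) :=
  {B | ∀ i j, B j i = -B i j}

/-- The sign `ε(i,j)` of `i - j`. -/
def eps {n : ℕ} (i j : Fin n) : ℝ :=
  if j < i then 1 else if i < j then -1 else 0

/-- The map `Φ` sending a positive matrix `A` to the triple
`(π_PC(A), (ε(i,j)·log √(a_{ij} a_{ji}))_{i ≠ j}, (log a_{ii})_i)`. -/
noncomputable def Phi {n : ℕ} (A : Matrix (Fin n) (Fin n) ℝ) :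
    Matrix (Fin n) (Fin n) ℝ × Matrix (Fin n) (Fin n) ℝ × (Fin n → ℝ) :=
  (piPC A,
   Matrix.of fun i j =>
     if i = j then 0 else eps i j * Real.log (Real.sqrt (A i j * A j i)),
   fun i => Real.log (A i i))

theorem aux_split (a b : ℝ) (ha : 0 < a) (hb : 0 < b) :
    a = Real.sqrt (a / b) * Real.sqrt (a * b) := by
  rw [← Real.sqrt_mul (by positivity)]
  have : a / b * (a * b) = a ^ 2 := by field_simp
  rw [this, Real.sqrt_sq ha.le]

theorem aux_eps_ne {n : ℕ} (i j : Fin n) (h : i ≠ j) : eps i j ≠ 0 := by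
  unfold eps
  rcases lt_or_gt_of_ne h with h | h
  · simp [h, h.not_gt]
  · simp [h]

theorem aux_eps_sq {n : ℕ} (i j : Fin n) (h : i ≠ j) : eps i j * eps i j = 1 := by
  unfold eps
  rcases lt_or_gt_of_ne h with h | h
  · simp [h, h.not_gt]
  · simp [h]

theorem aux_eps_symm {n : ℕ} (i j : Fin n) : eps j i = - eps i j := by
  unfold eps
  rcases lt_trichotomy i j with h | h | h
  · simp [h, h.not_gt]
  · simp [h]
  · simp [h, h.not_gt]

/-- `Φ` is a group isomorphism from the Hadamard group of positive `n × n` matrices onto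
the direct product `PC_n × (skew-symmetric matrices, +) × (ℝⁿ, +)`. -/
theorem Phi_group_isomorphism (n : ℕ) :
    Set.BijOn (Phi (n := n)) (PosSet n)
      (PCSet n ×ˢ (SkewSet n ×ˢ (Set.univ : Set (Fin n → ℝ)))) ∧
    ∀ A ∈ PosSet n, ∀ B ∈ PosSet n,
      Phi (A ⊙ B) =
        ((Phi A).1 ⊙ (Phi B).1, (Phi A).2.1 + (Phi B).2.1, (Phi A).2.2 + (Phi B).2.2) := by
  refine ⟨⟨?_, ?_, ?_⟩, ?_⟩
  · intro A hA
    refine ⟨⟨fun i j => ?_, fun i j => ?_⟩, fun i j => ?_, trivial⟩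
    · exact Real.sqrt_pos.2 (div_pos (hA i j) (hA j i))
    · simp only [Phi, piPC]
      rw [← Real.sqrt_inv, inv_div]
    · simp only [Phi, Matrix.of_apply]
      by_cases h : i = j
      · simp [h]
      · rw [if_neg h, if_neg (Ne.symm h), aux_eps_symm i j, mul_comm (A j i)]
        ring
  · intro A hA B hB hAB
    simp only [Phi, Prod.mk.injEq] at hAB
    obtain ⟨h1, h2, h3⟩ := hAB
    ext i j
    by_cases h : i = j
    · subst h
      exact Real.log_injOn_pos (hA i i) (hB i i) (congrFun h3 i)
    · have e1 : Real.sqrt (A i j / A j i) = Real.sqrt (B i j / B j i) :=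
        congrFun (congrFun h1 i) j
      have e2 := congrFun (congrFun h2 i) j
      simp only [Matrix.of_apply, if_neg h] at e2
      have e3 := mul_left_cancel₀ (aux_eps_ne i j h) e2
      have e4 := Real.log_injOn_pos (Real.sqrt_pos.2 (mul_pos (hA i j) (hA j i)))
        (Real.sqrt_pos.2 (mul_pos (hB i j) (hB j i))) e3
      rw [aux_split _ _ (hA i j) (hA j i), aux_split _ _ (hB i j) (hB j i), e1, e4]
  · rintro ⟨C, S, v⟩ ⟨⟨hC, hC'⟩, hS, -⟩
    simp only at hC hC' hS
    have hS' : ∀ i j, S j i = - S i j := hS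
    have hd : ∀ i, C i i = 1 := by
      intro i
      have h := hC' i i
      have hp := hC i i
      have h2 : C i i * C i i = 1 := by
        nth_rewrite 1 [h]
        exact inv_mul_cancel₀ hp.ne'
      nlinarith
    have hE : ∀ i j, eps j i * S j i = eps i j * S i j := by
      intro i j
      rw [aux_eps_symm i j, hS' i j]
      ring
    refine ⟨Matrix.of fun i j => if i = j then Real.exp (v i) else
      C i j * Real.exp (eps i j * S i j), ?_, ?_⟩
    · intro i j
      simp only [Matrix.of_apply]
      split_ifs
      · exact Real.exp_pos _
      · exact mul_pos (hC i j) (Real.exp_pos _)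
    · simp only [Phi, Prod.mk.injEq]
      refine ⟨?_, ?_, ?_⟩
      · ext i j
        simp only [piPC, Matrix.of_apply]
        by_cases h : i = j
        · subst h
          simp [hd]
        · rw [if_neg h, if_neg (Ne.symm h), hE i j, hC' i j]
          have hp := hC i j
          have : C i j * Real.exp (eps i j * S i j) /
              ((C i j)⁻¹ * Real.exp (eps i j * S i j)) = C i j ^ 2 := by
            field_simp
          rw [this, Real.sqrt_sq hp.le]
      · ext i j
        simp only [Matrix.of_apply]
        by_cases h : i = j
        · subst h
          have := hS' i i
          simp only [if_true]
          linarith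
        · rw [if_neg h, if_neg h, if_neg (Ne.symm h), hE i j, hC' i j]
          have hp := hC i j
          have : C i j * Real.exp (eps i j * S i j) *
              ((C i j)⁻¹ * Real.exp (eps i j * S i j)) = Real.exp (eps i j * S i j) ^ 2 := by
            field_simp
          rw [this, Real.sqrt_sq (Real.exp_pos _).le, Real.log_exp, ← mul_assoc,
            aux_eps_sq i j h, one_mul]
      · ext i
        simp
  · intro A hA B hB
    simp only [Phi, Prod.mk.injEq]
    refine ⟨?_, ?_, ?_⟩
    · ext i j
      simp only [piPC, Matrix.hadamard_apply]
      rw [← Real.sqrt_mul (div_pos (hA i j) (hA j i)).le, mul_div_mul_comm]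
    · ext i j
      simp only [Matrix.of_apply, Matrix.add_apply, Matrix.hadamard_apply]
      by_cases h : i = j
      · simp [h]
      · have pa := mul_pos (hA i j) (hA j i)
        have pb := mul_pos (hB i j) (hB j i)
        rw [if_neg h, if_neg h, if_neg h, mul_mul_mul_comm, Real.sqrt_mul pa.le,
          Real.log_mul (Real.sqrt_pos.2 pa).ne' (Real.sqrt_pos.2 pb).ne', mul_add]
    · ext i
      simp only [Pi.add_apply, Matrix.hadamard_apply]
      exact Real.log_mul (hA i i).ne' (hB i i).ne'
end
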